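/- Suppose χ₁ and χ₂ are both even characters. Let γ = (a, b; cq₁q₂, d) ∈ Γ₀(q₁q₂) and set γ' = (d, −c; −bq₁q₂, a) ∈ Γ₀(q₁q₂). Then S_{χ₁,χ₂}(γ) = S_{χ₂,χ₁}(γ'). -/

import Mathlib

open scoped MatrixGroups
open CongruenceSubgroup Matrix

/-- The first Bernoulli function `B₁(x)`: equal to `x - ⌊x⌋ - 1/2` for non-integral `x`
and `0` for integral `x`. -/
noncomputable def B1 (x : ℝ) : ℝ := if Int.fract x = 0 then 0 else Int.fract x - 1/2

/-- The newform Dedekind sum `S_{χ₁,χ₂}(a, c)`. -/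
noncomputable def ded {q₁ q₂ : ℕ} (χ₁ : DirichletCharacter ℂ q₁)
    (χ₂ : DirichletCharacter ℂ q₂) (a c : ℤ) : ℂ :=
  ∑ j ∈ Finset.range c.toNat, ∑ n ∈ Finset.range q₁,
    (starRingEnd ℂ) (χ₂ (j : ZMod q₂)) * (starRingEnd ℂ) (χ₁ (n : ZMod q₁)) *
      ((B1 ((j : ℝ) / (c : ℝ)) * B1 ((n : ℝ) / (q₁ : ℝ) + (a : ℝ) * (j : ℝ) / (c : ℝ)) : ℝ) : ℂ)

/-- The newform Dedekind sum `S_{χ₁,χ₂}(γ)` of a matrix `γ`. -/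
noncomputable def dedSL {q₁ q₂ : ℕ} (χ₁ : DirichletCharacter ℂ q₁)
    (χ₂ : DirichletCharacter ℂ q₂) (γ : SL(2, ℤ)) : ℂ :=
  if 0 < (γ : Matrix (Fin 2) (Fin 2) ℤ) 1 0 then
    ded χ₁ χ₂ ((γ : Matrix (Fin 2) (Fin 2) ℤ) 0 0) ((γ : Matrix (Fin 2) (Fin 2) ℤ) 1 0)
  else if (γ : Matrix (Fin 2) (Fin 2) ℤ) 1 0 < 0 then
    ded χ₁ χ₂ (-(γ : Matrix (Fin 2) (Fin 2) ℤ) 0 0) (-(γ : Matrix (Fin 2) (Fin 2) ℤ) 1 0)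
  else 0

open Finset in
lemma sum2 {M1 M2 N1 N2 : ℕ} (hN1 : 0 < N1) (hN2 : 0 < N2) (hM : M1 * M2 = N1 * N2)
    (G : ℤ → ℤ → ℂ) (hG1 : ∀ x y k, G (x + N1 * k) y = G x y)
    (hG2 : ∀ x y k, G x (y + N2 * k) = G x y) (p q : ℤ → ℤ → ℤ)
    (inj : ∀ x y x' y' : ℤ, (N1 : ℤ) ∣ p x y - p x' y' → (N2 : ℤ) ∣ q x y - q x' y' →
      (M1 : ℤ) ∣ x - x' ∧ (M2 : ℤ) ∣ y - y') :
    ∑ x ∈ range M1, ∑ y ∈ range M2, G (p x y) (q x y)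
      = ∑ x ∈ range N1, ∑ y ∈ range N2, G x y := by
  rw [← Finset.sum_product', ← Finset.sum_product']
  have hN1' : (N1 : ℤ) ≠ 0 := by positivity
  have hN2' : (N2 : ℤ) ≠ 0 := by positivity
  have hmem : ∀ z ∈ range M1 ×ˢ range M2,
      (((p z.1 z.2) % N1).toNat, ((q z.1 z.2) % N2).toNat) ∈ range N1 ×ˢ range N2 := by
    intro z _
    have h1 := Int.emod_lt_of_pos (p z.1 z.2) (by positivity : (0:ℤ) < N1)
    have h2 := Int.emod_lt_of_pos (q z.1 z.2) (by positivity : (0:ℤ) < N2)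
    have h3 := Int.emod_nonneg (p z.1 z.2) hN1'
    have h4 := Int.emod_nonneg (q z.1 z.2) hN2'
    simp only [mem_product, mem_range]
    constructor <;> omega
  have hinj : Set.InjOn (fun z : ℕ × ℕ => (((p z.1 z.2) % N1).toNat, ((q z.1 z.2) % N2).toNat))
      (range M1 ×ˢ range M2 : Finset (ℕ × ℕ)) := by
    rintro ⟨x, y⟩ h ⟨x', y'⟩ h' he
    simp only [coe_product, coe_range, Set.mem_prod, Set.mem_Iio] at h h'
    simp only [Prod.mk.injEq] at he
    have e1 : p x y % N1 = p x' y' % N1 := by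
      have h3 := Int.emod_nonneg (p x y) hN1'
      have h4 := Int.emod_nonneg (p x' y') hN1'
      omega
    have e2 : q x y % N2 = q x' y' % N2 := by
      have h3 := Int.emod_nonneg (q x y) hN2'
      have h4 := Int.emod_nonneg (q x' y') hN2'
      omega
    obtain ⟨d1, d2⟩ := inj x y x' y' (Int.ModEq.dvd (Int.ModEq.symm e1))
      (Int.ModEq.dvd (Int.ModEq.symm e2))
    have a1 := Int.eq_zero_of_abs_lt_dvd d1 (by rw [abs_lt]; omega)
    have a2 := Int.eq_zero_of_abs_lt_dvd d2 (by rw [abs_lt]; omega)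
    simp only [Prod.mk.injEq]
    omega
  refine Finset.sum_nbij _ hmem hinj ?_ ?_
  · exact Finset.surjOn_of_injOn_of_card_le _ (fun z hz => hmem z hz) hinj (by simp [hM])
  · rintro ⟨x, y⟩ _
    have h3 := Int.emod_nonneg (p x y) hN1'
    have h4 := Int.emod_nonneg (q x y) hN2'
    simp only [Int.toNat_of_nonneg h3, Int.toNat_of_nonneg h4]
    rw [← hG1 (p x y % N1) _ (p x y / N1), ← hG2 _ (q x y % N2) (q x y / N2),
      Int.emod_add_mul_ediv, Int.emod_add_mul_ediv]

open Finset in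
lemma sum1 {M : ℕ} (hM : 0 < M) (G : ℤ → ℂ) (hG : ∀ x k, G (x + M * k) = G x)
    (p : ℤ → ℤ) (inj : ∀ x x' : ℤ, (M : ℤ) ∣ p x - p x' → (M : ℤ) ∣ x - x') :
    ∑ x ∈ range M, G (p x) = ∑ x ∈ range M, G x := by
  have := sum2 (M1 := M) (M2 := 1) (N1 := M) (N2 := 1) hM one_pos rfl (fun x _ => G x)
    (fun x _ k => hG x k) (fun _ _ _ => rfl) (fun x _ => p x) (fun _ _ => 0)
    (fun x y x' y' h _ => ⟨inj _ _ h, by simp⟩)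
  simpa using this

lemma B1_add_int (x : ℝ) (k : ℤ) : B1 (x + k) = B1 x := by
  simp [B1]

lemma B1_neg (x : ℝ) : B1 (-x) = - B1 x := by
  unfold B1
  by_cases h : Int.fract x = 0
  · simp [h, Int.fract_neg_eq_zero]
  · rw [if_neg h, if_neg (by rwa [Int.fract_neg_eq_zero]), Int.fract_neg h]; ring

lemma B1_of_mem {x : ℝ} (h0 : 0 < x) (h1 : x < 1) : B1 x = x - 1/2 := by
  have : Int.fract x = x := Int.fract_eq_self.2 ⟨h0.le, h1⟩
  rw [B1, this, if_neg h0.ne']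

lemma B1_zero : B1 0 = 0 := by simp [B1]

open Finset in
lemma B1_dist (h : ℕ) (hh : 0 < h) (t : ℝ) :
    ∑ s ∈ range h, B1 (t + s / h) = B1 (h * t) := by
  have hr : (0:ℝ) < h := by exact_mod_cast hh
  -- the sum is periodic mod 1 / h
  have hper : ∀ k : ℤ, ∀ t : ℝ, ∑ s ∈ range h, B1 (t + k / h + s / h) = ∑ s ∈ range h, B1 (t + s / h) := by
    intro k t
    have := sum1 hh (fun x => (B1 (t + x / h) : ℂ)) (by
      intro x k
      have : t + ((x + h * k : ℤ) : ℝ) / h = t + x / h + k := by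
        push_cast; field_simp; ring
      simp only [this, B1_add_int]) (fun x => x + k) (by intro x x' h; simpa using h)
    have h2 : ((∑ s ∈ range h, B1 (t + k / h + s / h) : ℝ) : ℂ) = ((∑ s ∈ range h, B1 (t + s / h) : ℝ) : ℂ) := by
      push_cast
      refine Eq.trans ?_ (this.trans ?_)
      · refine sum_congr rfl fun s _ => ?_
        congr 2; push_cast; ring
      · refine sum_congr rfl fun s _ => ?_
        congr 2
    exact_mod_cast h2
  have hg : ∀ m : ℕ, ∑ s ∈ range m, (s : ℝ) = m * (m - 1) / 2 := by
    intro m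
    induction m with
    | zero => simp
    | succ m ih => rw [sum_range_succ, ih]; push_cast; ring
  have hbase : ∀ t : ℝ, 0 ≤ t → t < 1 / h → ∑ s ∈ range h, B1 (t + s / h) = B1 (h * t) := by
    intro t h0 h1
    have h1' : h * t < 1 := by rw [lt_div_iff₀ hr] at h1; linarith
    have hs : ∀ s : ℕ, s < h → t + s / h < 1 := by
      intro s hs
      have : (s : ℝ) + 1 ≤ h := by exact_mod_cast hs
      have h2 : ((s : ℝ) + 1) / h ≤ 1 := by rw [div_le_one hr]; exact this
      rw [add_div] at h2; linarith
    rcases h0.eq_or_lt with h0 | h0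
    · subst h0
      obtain ⟨m, rfl⟩ : ∃ m, h = m + 1 := ⟨h - 1, by omega⟩
      rw [sum_range_succ']
      simp only [Nat.cast_zero, zero_div, add_zero, mul_zero, B1_zero]
      have : ∀ s ∈ range m, B1 (0 + ((s + 1 : ℕ) : ℝ) / (m + 1 : ℕ)) = (s + 1) / (m + 1) - 1 / 2 := by
        intro s hs'
        rw [B1_of_mem]
        · push_cast; ring
        · rw [zero_add]; positivity
        · exact hs _ (by simp at hs'; omega)
      rw [sum_congr rfl this, sum_sub_distrib, ← sum_div, sum_add_distrib, hg]
      simp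
      field_simp
      ring
    · have : ∀ s ∈ range h, B1 (t + s / h) = (t - 1/2) + s / h := by
        intro s hs'
        rw [B1_of_mem (by positivity) (hs _ (by simpa using hs'))]
        ring
      rw [sum_congr rfl this, sum_add_distrib, ← sum_div, hg, B1_of_mem (by positivity) h1']
      simp
      field_simp
      ring
  have key := hbase (Int.fract (h * t) / h) (by positivity) (by
    gcongr; exact Int.fract_lt_one _)
  have e : t = Int.fract (h * t) / h + (⌊h * t⌋ : ℤ) / h := by
    have := Int.fract_add_floor (h * t)
    rw [← add_div, this]
    field_simp
  have e2 : B1 (h * t) = B1 (h * (Int.fract (h * t) / h)) := by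
    rw [mul_div_cancel₀ _ hr.ne']
    conv_lhs => rw [← Int.fract_add_floor (h * t)]
    rw [B1_add_int]
  rw [e2, ← key]
  conv_lhs => rw [e]
  exact hper _ _

open Finset in
lemma sum_split (q d : ℕ) (F : ℕ → ℂ) :
    ∑ J ∈ range (d * q), F J = ∑ n ∈ range q, ∑ s ∈ range d, F (s * q + n) := by
  rw [sum_comm]
  induction d with
  | zero => simp
  | succ d ih => rw [Nat.succ_mul, sum_range_add, ih, sum_range_succ]

lemma per_mul {q : ℕ} {g : ℤ → ℂ} (hg : ∀ x k, g (x + q * k) = g x) {M : ℤ} (h : (q : ℤ) ∣ M)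
    (x k : ℤ) : g (x + M * k) = g x := by
  obtain ⟨e, rfl⟩ := h
  rw [mul_assoc, hg]

open Finset in
lemma dist_char (q d : ℕ) (hq : 0 < q) (hd : 0 < d) (g : ℤ → ℂ) (hg : ∀ x k, g (x + q * k) = g x)
    (u : ℝ) : ∑ J ∈ range (d * q), g J * (B1 (u + J / (d * q)) : ℂ)
      = ∑ n ∈ range q, g n * (B1 (n / q + d * u) : ℂ) := by
  rw [sum_split]
  refine sum_congr rfl fun n _ => ?_
  have : ∀ s ∈ range d, g ((s * q + n : ℕ) : ℤ) * (B1 (u + ((s * q + n : ℕ) : ℝ) / (d * q)) : ℂ)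
      = g n * (B1 ((u + n / (d * q)) + s / d) : ℂ) := by
    intro s _
    have h1 : ((s * q + n : ℕ) : ℤ) = n + q * s := by push_cast; ring
    rw [h1, hg]
    congr 3
    push_cast
    field_simp
    ring
  rw [sum_congr rfl this, ← mul_sum, ← Complex.ofReal_sum, B1_dist d hd]
  congr 3
  field_simp
  ring

lemma B1_id (u v : ℝ) : (B1 u + B1 v) * B1 (u + v) =
    (Int.fract u - 1/2)^2 / 2 + (Int.fract v - 1/2)^2 / 2 + (Int.fract (u + v) - 1/2)^2 / 2
     + B1 u * B1 v - 1/8 - (if Int.fract u = 0 then 1/4 else 0) * (if Int.fract v = 0 then 1 else 0) := by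
  have hu0 := Int.fract_nonneg u
  have hv0 := Int.fract_nonneg v
  have hu1 := Int.fract_lt_one u
  have hv1 := Int.fract_lt_one v
  have hw : Int.fract (u + v) = Int.fract (Int.fract u + Int.fract v) := by
    conv_lhs => rw [← Int.fract_add_floor u, ← Int.fract_add_floor v]
    rw [show Int.fract u + ⌊u⌋ + (Int.fract v + ⌊v⌋) = Int.fract u + Int.fract v + (⌊u⌋ + ⌊v⌋ : ℤ) by
      push_cast; ring, Int.fract_add_intCast]
  unfold B1
  rw [hw]
  generalize Int.fract u = x at *
  generalize Int.fract v = y at *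
  rcases lt_or_ge (x + y) 1 with h | h
  · rw [Int.fract_eq_self.2 ⟨by linarith, h⟩]
    by_cases hx : x = 0
    · by_cases hy : y = 0
      · simp [hx, hy]; norm_num
      · simp [hx, hy]; ring
    · have hxy : x + y ≠ 0 := fun h => hx (by linarith)
      by_cases hy : y = 0
      · simp [hx, hy]; ring
      · simp [hx, hy, hxy]; ring
  · have : Int.fract (x + y) = x + y - 1 := by
      rw [Int.fract_eq_iff]; exact ⟨by linarith, by linarith, 1, by push_cast; ring⟩
    rw [this]
    have hx : x ≠ 0 := fun h => by linarith
    have hy : y ≠ 0 := fun h => by linarith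
    by_cases hxy : x + y - 1 = 0
    · have : y = 1 - x := by linarith
      subst this
      simp [hx, hy]; ring
    · simp [hx, hy, hxy]; ring

open Finset in
lemma sum_eq_zero_mul (q d : ℕ) (g : ℤ → ℂ) (hg : ∀ x k, g (x + q * k) = g x)
    (h0 : ∑ n ∈ range q, g n = 0) : ∑ n ∈ range (d * q), g n = 0 := by
  rw [sum_split, sum_comm]
  refine sum_eq_zero fun s _ => ?_
  rw [← h0]
  refine sum_congr rfl fun n _ => ?_
  rw [← hg n s]; congr 1; push_cast; ring

/-- sums of an even function against an odd one -/
lemma sum_even_odd {M : ℕ} (hM : 0 < M) (F : ℤ → ℂ) (hF : ∀ x k, F (x + M * k) = F x)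
    (ho : ∀ x, F (-x) = - F x) : ∑ n ∈ Finset.range M, F n = 0 := by
  have := sum1 hM F hF (fun x => -x) (fun x x' h => by
    have := (dvd_neg.2 h); rw [neg_sub_neg, neg_sub] at this; exact this)
  simp only [ho, Finset.sum_neg_distrib] at this
  have h2 := self_eq_neg.1 this.symm
  exact h2

open Finset in
lemma sum_cop {q d : ℕ} (hq : 0 < q) (hd : 0 < d) (hc : IsCoprime (d : ℤ) q) (g H : ℤ → ℂ)
    (hg : ∀ x k, g (x + q * k) = g x) (hH : ∀ x k, H (x + d * k) = H x)
    (h0 : ∑ n ∈ range q, g n = 0) : ∑ n ∈ range (d * q), g n * H n = 0 := by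
  have h := sum2 (M1 := q) (M2 := d) (N1 := d * q) (N2 := 1) (by positivity) one_pos
    (by ring) (fun x _ => g x * H x) (fun x _ k => by
      rw [per_mul hg (by push_cast; exact dvd_mul_left _ _),
        per_mul hH (by push_cast; exact dvd_mul_right _ _)]) (fun _ _ _ => rfl)
    (fun x y => d * x + q * y) (fun _ _ => 0) (by
      intro x y x' y' h _
      have e : (d * x + q * y) - (d * x' + q * y') = (d : ℤ) * (x - x') + q * (y - y') := by ring
      rw [e] at h
      push_cast at h
      constructor
      · have h1 := (dvd_mul_left (q:ℤ) d).trans h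
        rw [dvd_add_left (dvd_mul_right _ _)] at h1
        exact hc.symm.dvd_of_dvd_mul_left h1
      · have h1 := (dvd_mul_right (d:ℤ) q).trans h
        rw [dvd_add_right (dvd_mul_right _ _)] at h1
        exact hc.dvd_of_dvd_mul_left h1)
  simp only [range_one, sum_singleton] at h
  rw [← h, sum_comm]
  refine sum_eq_zero fun y _ => ?_
  have h1 : ∀ x ∈ range q, g (d * (x:ℤ) + q * y) * H (d * (x:ℤ) + q * y) = g (d * x) * H (q * y) := by
    intro x _
    rw [hg, add_comm, hH]
  rw [sum_congr rfl h1, ← sum_mul, sum1 hq g hg (fun x => d * x) (by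
    intro x x' h
    rw [← mul_sub] at h
    exact hc.symm.dvd_of_dvd_mul_left h), h0, zero_mul]

/-- The properties of a nontrivial even Dirichlet character mod `q` that are used. -/
structure CharLike (q : ℕ) (f : ℤ → ℂ) : Prop where
  pos : 0 < q
  per : ∀ x k, f (x + q * k) = f x
  even : ∀ x, f (-x) = f x
  zero : ∀ x, (q : ℤ) ∣ x → f x = 0
  sum : ∑ n ∈ Finset.range q, f n = 0
  mul : ∀ x y, f (x * y) = f x * f y
  one : f 1 = 1

open Finset in
/-- The Dedekind sum for functions. -/
noncomputable def DD (f g : ℤ → ℂ) (q₁ M : ℕ) (a : ℤ) : ℂ :=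
  ∑ j ∈ range M, ∑ n ∈ range q₁, f j * g n *
    ((B1 ((j : ℝ) / M) * B1 ((n : ℝ) / q₁ + a * j / M) : ℝ) : ℂ)

open Finset in
/-- The dual sum. -/
noncomputable def WW (f g : ℤ → ℂ) (q₁ q₂ d : ℕ) (c : ℤ) : ℂ :=
  ∑ J ∈ range (d * q₁), ∑ m ∈ range q₂, g J * f m *
    ((B1 ((J : ℝ) / (d * q₁)) * B1 ((m : ℝ) / q₂ + c * J / d) : ℝ) : ℂ)

open Finset in
lemma eta_sum {q₁ q₂ c d : ℕ} {f g : ℤ → ℂ} (hf : CharLike q₂ f) (hg : CharLike q₁ g)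
    (hc : 0 < c) (hd : 0 < d) (a b : ℤ) (hdet : a * d - b * (c * (q₁ * q₂)) = 1)
    (η : ℝ → ℂ) (hη : ∀ x (k : ℤ), η (x + k) = η x) :
    ∑ J ∈ range (d * q₁), ∑ I ∈ range (c * q₁ * q₂), f I * g J *
      η ((I : ℝ) / (c * q₁ * q₂) + (J : ℝ) / (d * q₁)) = 0 := by
  have hq₁ := hg.pos
  have hq₂ := hf.pos
  have hdetR : (a : ℝ) * d - b * (c * (q₁ * q₂)) = 1 := by exact_mod_cast hdet
  have step : ∀ J ∈ range (d * q₁), ∑ I ∈ range (c * q₁ * q₂), f I * g J *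
      η ((I : ℝ) / (c * q₁ * q₂) + (J : ℝ) / (d * q₁)) =
      ∑ I ∈ range (c * q₁ * q₂), f I * g J *
      η ((I : ℝ) / (c * q₁ * q₂) - b * c * q₂ * J / d) := by
    intro J _
    have h := sum1 (M := c * q₁ * q₂) (by positivity)
      (fun x => f x * g J * η ((x : ℝ) / (c * q₁ * q₂) - b * c * q₂ * J / d))
      (by
        intro x k
        rw [per_mul hf.per (by push_cast; exact dvd_mul_left _ _)]
        congr 1
        symm; rw [← hη _ k]
        congr 1
        push_cast
        field_simp
        ring)
      (fun x => x + a * c * q₂ * J) (by intro x x' h; simpa using h)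
    refine Eq.trans ?_ (h.trans (by simp))
    refine sum_congr rfl fun I _ => ?_
    rw [show (I : ℤ) + a * c * q₂ * J = I + q₂ * (a * c * J) by ring, hf.per]
    congr 2
    push_cast
    field_simp
    linear_combination (-(J : ℝ) * q₂ * c) * hdetR
  rw [sum_congr rfl step, sum_comm]
  refine sum_eq_zero fun I _ => ?_
  have hcop : IsCoprime (d : ℤ) q₁ := ⟨a, -b * c * q₂, by linear_combination hdet⟩
  have := sum_cop hq₁ hd hcop g
    (fun J => η ((I : ℝ) / (c * q₁ * q₂) - b * c * q₂ * J / d)) hg.per (by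
      intro x k
      symm; rw [← hη _ (-(b * c * q₂ * k))]
      congr 1
      push_cast
      field_simp
      ring) hg.sum
  simp only [mul_assoc, ← mul_sum] at this ⊢
  simp only [Int.cast_natCast] at this
  rw [this, mul_zero]

open Finset in
lemma T_zero {q₁ q₂ c d : ℕ} {f g : ℤ → ℂ} (hf : CharLike q₂ f) (hg : CharLike q₁ g)
    (hc : 0 < c) (hd : 0 < d) (a b : ℤ) (hdet : a * d - b * (c * (q₁ * q₂)) = 1) :
    ∑ J ∈ range (d * q₁), ∑ I ∈ range (c * q₁ * q₂), f I * g J *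
      (((B1 ((I : ℝ) / (c * q₁ * q₂)) + B1 ((J : ℝ) / (d * q₁))) *
        B1 ((I : ℝ) / (c * q₁ * q₂) + (J : ℝ) / (d * q₁)) : ℝ) : ℂ) = 0 := by
  have hq₁ := hg.pos
  have hq₂ := hf.pos
  have sf : ∑ I ∈ range (c * q₁ * q₂), f I = 0 := sum_eq_zero_mul q₂ (c * q₁) f hf.per hf.sum
  have sg : ∑ J ∈ range (d * q₁), g J = 0 := sum_eq_zero_mul q₁ d g hg.per hg.sum
  have sfB : ∑ I ∈ range (c * q₁ * q₂), f I * (B1 ((I : ℝ) / (c * q₁ * q₂)) : ℂ) = 0 := by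
    have := sum_even_odd (M := c * q₁ * q₂) (by positivity)
      (fun x => f x * (B1 ((x : ℝ) / (c * q₁ * q₂)) : ℂ)) (by
        intro x k
        rw [per_mul hf.per (by push_cast; exact dvd_mul_left _ _)]
        congr 2
        symm; rw [← B1_add_int _ k]
        congr 1
        push_cast
        field_simp) (by
        intro x
        rw [hf.even]
        push_cast
        rw [neg_div, B1_neg]
        push_cast
        ring)
    simpa using this
  have eta := eta_sum hf hg hc hd a b hdet (fun x => (((Int.fract x - 1/2)^2 / 2 : ℝ) : ℂ))
    (by intro x k; simp)
  have hz : ∀ J : ℕ, g J * (((if Int.fract ((J : ℝ) / (d * q₁)) = 0 then 1 else 0) : ℝ) : ℂ) = 0 := by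
    intro J
    split_ifs with h
    · rw [Int.fract_eq_zero_iff] at h
      obtain ⟨k, hk⟩ := h
      rw [hg.zero, zero_mul]
      refine ⟨d * k, ?_⟩
      have : (J : ℝ) = q₁ * (d * k) := by
        field_simp at hk
        linarith
      exact_mod_cast this
    · simp
  have expand : ∀ J ∈ range (d * q₁), ∀ I ∈ range (c * q₁ * q₂), f I * g J *
      (((B1 ((I : ℝ) / (c * q₁ * q₂)) + B1 ((J : ℝ) / (d * q₁))) *
        B1 ((I : ℝ) / (c * q₁ * q₂) + (J : ℝ) / (d * q₁)) : ℝ) : ℂ) =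
      g J * (f I * (((Int.fract ((I : ℝ) / (c * q₁ * q₂)) - 1/2)^2 / 2 : ℝ) : ℂ))
      + (g J * (((Int.fract ((J : ℝ) / (d * q₁)) - 1/2)^2 / 2 - 1 / 8: ℝ) : ℂ)) * f I
      + f I * g J * (((Int.fract ((I : ℝ) / (c * q₁ * q₂) + (J : ℝ) / (d * q₁)) - 1/2)^2 / 2 : ℝ) : ℂ)
      + (g J * (B1 ((J : ℝ) / (d * q₁)) : ℂ)) * (f I * (B1 ((I : ℝ) / (c * q₁ * q₂)) : ℂ)) := by
    intro J _ I _
    rw [B1_id]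
    have := hz J
    push_cast at this ⊢
    linear_combination (-f I * (((if Int.fract ((I : ℝ) / (c * q₁ * q₂)) = 0 then 1/4 else 0) : ℝ) : ℂ)) * this
  rw [sum_congr rfl fun J hJ => sum_congr rfl (expand J hJ)]
  simp only [sum_add_distrib, ← mul_sum, sf, sfB, mul_zero, add_zero]
  rw [eta, ← sum_mul, sg]
  simp

open Finset in
lemma recip {q₁ q₂ c d : ℕ} {f g : ℤ → ℂ} (hf : CharLike q₂ f) (hg : CharLike q₁ g)
    (hc : 0 < c) (hd : 0 < d) (a b : ℤ) (hdet : a * d - b * (c * (q₁ * q₂)) = 1) :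
    DD f g q₁ (c * q₁ * q₂) d = - WW f g q₁ q₂ d c := by
  have hq₁ := hg.pos
  have hq₂ := hf.pos
  have hT := T_zero hf hg hc hd a b hdet
  have e1 : DD f g q₁ (c * q₁ * q₂) d = ∑ J ∈ range (d * q₁), ∑ I ∈ range (c * q₁ * q₂), f I * g J *
      ((B1 ((I : ℝ) / (c * q₁ * q₂)) *
        B1 ((I : ℝ) / (c * q₁ * q₂) + (J : ℝ) / (d * q₁)) : ℝ) : ℂ) := by
    rw [sum_comm]
    unfold DD
    refine sum_congr rfl fun I _ => ?_
    have := dist_char q₁ d hq₁ hd g hg.per ((I : ℝ) / (c * q₁ * q₂))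
    have h2 := congrArg (fun z => f I * (B1 ((I : ℝ) / (c * q₁ * q₂)) : ℂ) * z) this
    simp only [mul_sum] at h2
    refine Eq.trans (sum_congr rfl fun n _ => ?_) (h2.symm.trans (sum_congr rfl fun n _ => ?_))
    · push_cast
      rw [mul_div_assoc]
      ring
    · push_cast
      ring
  have e2 : WW f g q₁ q₂ d c = ∑ J ∈ range (d * q₁), ∑ I ∈ range (c * q₁ * q₂), f I * g J *
      ((B1 ((J : ℝ) / (d * q₁)) *
        B1 ((I : ℝ) / (c * q₁ * q₂) + (J : ℝ) / (d * q₁)) : ℝ) : ℂ) := by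
    unfold WW
    refine sum_congr rfl fun J _ => ?_
    have := dist_char q₂ (c * q₁) hq₂ (by positivity) f hf.per ((J : ℝ) / (d * q₁))
    have h2 := congrArg (fun z => g J * (B1 ((J : ℝ) / (d * q₁)) : ℂ) * z) this
    simp only [mul_sum] at h2
    refine Eq.trans (sum_congr rfl fun n _ => ?_) (h2.symm.trans (sum_congr rfl fun n _ => ?_))
    · have : ((c : ℤ) : ℝ) * J / d = ((c * q₁ : ℕ) : ℝ) * ((J : ℝ) / (d * q₁)) := by
        push_cast; field_simp
      rw [this]
      push_cast
      ring
    · push_cast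
      rw [add_comm ((J : ℝ) / (d * q₁))]
      ring
  rw [eq_neg_iff_add_eq_zero, e1, e2, ← hT, ← sum_add_distrib]
  refine sum_congr rfl fun J _ => ?_
  rw [← sum_add_distrib]
  refine sum_congr rfl fun I _ => ?_
  push_cast
  ring

open Finset in
lemma change1 {q₁ q₂ c : ℕ} {f g : ℤ → ℂ} (hf : CharLike q₂ f) (hg : CharLike q₁ g)
    (hc : 0 < c) (a b d : ℤ) (hdet : a * d - b * (c * (q₁ * q₂)) = 1) :
    DD f g q₁ (c * q₁ * q₂) d = f a * g d * DD f g q₁ (c * q₁ * q₂) a := by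
  have hq₁ := hg.pos
  have hq₂ := hf.pos
  have hdetR : (a : ℝ) * d - b * (c * (q₁ * q₂)) = 1 := by exact_mod_cast hdet
  have h := sum2 (M1 := c * q₁ * q₂) (M2 := q₁) (N1 := c * q₁ * q₂) (N2 := q₁) (by positivity) hq₁ rfl
    (fun K n => f K * g n *
      ((B1 ((K : ℝ) / (c * q₁ * q₂ : ℕ)) * B1 ((n : ℝ) / q₁ + d * K / (c * q₁ * q₂ : ℕ)) : ℝ) : ℂ))
    (by
      intro x y k
      rw [per_mul hf.per (by push_cast; exact dvd_mul_left _ _)]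
      congr 2
      congr 1
      · symm; rw [← B1_add_int _ k]
        congr 1
        push_cast
        field_simp
      · symm; rw [← B1_add_int _ (d * k)]
        congr 1
        push_cast
        field_simp
        ring)
    (by
      intro x y k
      rw [hg.per]
      congr 3
      symm; rw [← B1_add_int _ k]
      congr 1
      push_cast
      field_simp
      ring)
    (fun J n => a * J + n * c * q₂) (fun J n => - d * n)
    (by
      rintro x y x' y' ⟨e1, h1⟩ ⟨e2, h2⟩
      push_cast at h1 ⊢
      have hy : (q₁ : ℤ) ∣ y - y' := by
        refine ⟨- a * e2 - b * c * q₂ * (y - y'), ?_⟩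
        linear_combination (-a) * h2 - (y - y') * hdet
      refine ⟨?_, hy⟩
      refine ⟨d * e1 + e2 - b * (x - x'), ?_⟩
      linear_combination d * h1 - (x - x') * hdet + c * q₂ * h2)
  unfold DD
  have h' := h.symm
  simp only [Int.cast_natCast] at h'
  rw [h', mul_sum]
  refine sum_congr rfl fun J _ => ?_
  rw [mul_sum]
  refine sum_congr rfl fun n _ => ?_
  rw [show a * (J : ℤ) + n * c * q₂ = a * J + q₂ * (n * c) by ring, hf.per, hf.mul, hg.mul, hg.even]
  have a1 : ((a * J + q₂ * (n * c) : ℤ) : ℝ) / (c * q₁ * q₂ : ℕ) = (n : ℝ) / q₁ + a * J / (c * q₁ * q₂ : ℕ) := by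
    push_cast
    field_simp
    ring
  have a2 : ((-d * n : ℤ) : ℝ) / q₁ + d * ((a * J + q₂ * (n * c) : ℤ) : ℝ) / (c * q₁ * q₂ : ℕ) =
      (J : ℝ) / (c * q₁ * q₂ : ℕ) + (b * J : ℤ) := by
    push_cast
    field_simp
    linear_combination (J : ℝ) * hdetR
  rw [a1, a2, B1_add_int]
  push_cast
  ring

open Finset in
lemma change2 {q₁ q₂ d : ℕ} {f g : ℤ → ℂ} (hf : CharLike q₂ f) (hg : CharLike q₁ g)
    (hd : 0 < d) (a b c : ℤ) (hdet : a * d - b * (c * (q₁ * q₂)) = 1) :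
    WW g f q₂ q₁ d (-b) = f d * g a * WW f g q₁ q₂ d c := by
  have hq₁ := hg.pos
  have hq₂ := hf.pos
  have hdetR : (a : ℝ) * d - b * (c * (q₁ * q₂)) = 1 := by exact_mod_cast hdet
  have h := sum2 (M1 := d * q₁) (M2 := q₂) (N1 := d * q₂) (N2 := q₁) (by positivity) hq₁ (by ring)
    (fun K n => f K * g n *
      ((B1 ((K : ℝ) / (d * q₂)) * B1 ((n : ℝ) / q₁ + (-b : ℤ) * K / d) : ℝ) : ℂ))
    (by
      intro x y k
      rw [per_mul hf.per (by push_cast; exact dvd_mul_left _ _)]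
      congr 2
      congr 1
      · symm; rw [← B1_add_int _ k]
        congr 1
        push_cast
        field_simp
      · symm; rw [← B1_add_int _ (-b * q₂ * k)]
        congr 1
        push_cast
        field_simp
        ring)
    (by
      intro x y k
      rw [hg.per]
      congr 3
      symm; rw [← B1_add_int _ k]
      congr 1
      push_cast
      field_simp
      ring)
    (fun J m => c * q₂ * J + m * d) (fun J n => a * J)
    (by
      rintro x y x' y' ⟨e1, h1⟩ ⟨e2, h2⟩
      push_cast at h1 ⊢
      constructor
      · refine ⟨-b * q₂ * e1 + b * (y - y') + e2, ?_⟩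
        linear_combination d * h2 - b * q₁ * h1 - (x - x') * hdet
      · refine ⟨a * d * e1 - a * c * (x - x') - b * c * q₁ * (y - y'), ?_⟩
        linear_combination a * h1 - (y - y') * hdet)
  unfold WW
  have h' := h.symm
  simp only [Int.cast_natCast] at h'
  rw [h', mul_sum]
  refine sum_congr rfl fun J _ => ?_
  rw [mul_sum]
  refine sum_congr rfl fun m _ => ?_
  rw [show c * q₂ * (J : ℤ) + m * d = d * m + q₂ * (c * J) by ring, hf.per, hf.mul, hg.mul]
  have a1 : ((d * m + q₂ * (c * J) : ℤ) : ℝ) / (d * q₂) = (m : ℝ) / q₂ + c * J / d := by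
    push_cast
    field_simp
  have a2 : ((a * J : ℤ) : ℝ) / q₁ + (-b : ℤ) * ((d * m + q₂ * (c * J) : ℤ) : ℝ) / d =
      (J : ℝ) / (d * q₁) + (-b * m : ℤ) := by
    push_cast
    field_simp
    linear_combination (J : ℝ) * hdetR
  rw [a1, a2, B1_add_int]
  push_cast
  ring

open Finset in
lemma sum_B1_neg {q : ℕ} {g : ℤ → ℂ} (hg : CharLike q g) (t : ℝ) :
    ∑ n ∈ range q, g n * (B1 ((n : ℝ) / q + -t) : ℂ)
      = - ∑ n ∈ range q, g n * (B1 ((n : ℝ) / q + t) : ℂ) := by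
  have hq := hg.pos
  have h := sum1 hq (fun n => g n * (B1 ((n : ℝ) / q + -t) : ℂ)) (by
      intro x k
      rw [hg.per]
      congr 2
      symm; rw [← B1_add_int _ k]
      congr 1
      push_cast
      field_simp
      ring) (fun x => -x) (fun x x' h => by
    have := (dvd_neg.2 h); rw [neg_sub_neg, neg_sub] at this; exact this)
  simp only [Int.cast_natCast] at h
  rw [← h, ← sum_neg_distrib]
  refine sum_congr rfl fun n _ => ?_
  rw [hg.even]
  have : ((-(n : ℤ) : ℤ) : ℝ) / q + -t = -((n : ℝ) / q + t) := by push_cast; ring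
  rw [this, B1_neg]
  push_cast
  ring

lemma DD_neg {q₁ : ℕ} {f g : ℤ → ℂ} (hg : CharLike q₁ g) (M : ℕ) (a : ℤ) :
    DD f g q₁ M (-a) = - DD f g q₁ M a := by
  unfold DD
  rw [← Finset.sum_neg_distrib]
  refine Finset.sum_congr rfl fun J _ => ?_
  have h := congrArg (fun z => f J * (B1 ((J : ℝ) / M) : ℂ) * z) (sum_B1_neg hg (a * J / M))
  simp only [mul_neg, Finset.mul_sum] at h
  refine Eq.trans (Finset.sum_congr rfl fun n _ => ?_)
    (h.trans (congrArg _ (Finset.sum_congr rfl fun n _ => ?_)))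
  · rw [show ((-a : ℤ) : ℝ) * J / M = -(a * J / M) by push_cast; ring]
    push_cast
    ring
  · push_cast
    ring

lemma WW_neg {q₁ q₂ : ℕ} {f g : ℤ → ℂ} (hf : CharLike q₂ f) (d : ℕ) (c : ℤ) :
    WW f g q₁ q₂ d (-c) = - WW f g q₁ q₂ d c := by
  unfold WW
  rw [← Finset.sum_neg_distrib]
  refine Finset.sum_congr rfl fun J _ => ?_
  have h := congrArg (fun z => g J * (B1 ((J : ℝ) / (d * q₁)) : ℂ) * z) (sum_B1_neg hf (c * J / d))
  simp only [mul_neg, Finset.mul_sum] at h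
  refine Eq.trans (Finset.sum_congr rfl fun n _ => ?_)
    (h.trans (congrArg _ (Finset.sum_congr rfl fun n _ => ?_)))
  · rw [show ((-c : ℤ) : ℝ) * J / d = -(c * J / d) by push_cast; ring]
    push_cast
    ring
  · push_cast
    ring

/-- Signed version of `DD`. -/
noncomputable def XX (f g : ℤ → ℂ) (q₁ q₂ : ℕ) (a c : ℤ) : ℂ :=
  if 0 < c then DD f g q₁ (c.toNat * q₁ * q₂) a
  else if c < 0 then DD f g q₁ ((-c).toNat * q₁ * q₂) (-a) else 0

lemma XX_neg (f g : ℤ → ℂ) (q₁ q₂ : ℕ) (a c : ℤ) :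
    XX f g q₁ q₂ (-a) (-c) = XX f g q₁ q₂ a c := by
  unfold XX
  rcases lt_trichotomy c 0 with h | h | h
  · rw [if_pos (by omega), if_neg (by omega), if_pos h]
  · subst h; simp
  · rw [if_neg (by omega), if_pos (by omega), if_pos h, neg_neg, neg_neg]

lemma XX_recip {q₁ q₂ d : ℕ} {f g : ℤ → ℂ} (hf : CharLike q₂ f) (hg : CharLike q₁ g)
    (hd : 0 < d) (a b c : ℤ) (hdet : a * d - b * (c * (q₁ * q₂)) = 1) :
    XX f g q₁ q₂ d c = - WW f g q₁ q₂ d c := by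
  unfold XX
  rcases lt_trichotomy c 0 with h | h | h
  · rw [if_neg (by omega), if_pos h, DD_neg hg]
    obtain ⟨m, rfl⟩ : ∃ m : ℕ, c = -m := ⟨(-c).toNat, by omega⟩
    rw [neg_neg, Int.toNat_natCast, recip hf hg (by omega) hd a (-b) (by linarith), WW_neg hf]
  · subst h
    have := WW_neg (q₁ := q₁) (g := g) hf d 0
    rw [neg_zero] at this
    simp [self_eq_neg.1 this]
  · rw [if_pos h]
    obtain ⟨m, rfl⟩ : ∃ m : ℕ, c = m := ⟨c.toNat, by omega⟩
    rw [Int.toNat_natCast, recip hf hg (by omega) hd a b hdet]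

lemma XX_change {q₁ q₂ : ℕ} {f g : ℤ → ℂ} (hf : CharLike q₂ f) (hg : CharLike q₁ g)
    (a b c d : ℤ) (hdet : a * d - b * (c * (q₁ * q₂)) = 1) :
    XX f g q₁ q₂ d c = f a * g d * XX f g q₁ q₂ a c := by
  unfold XX
  rcases lt_trichotomy c 0 with h | h | h
  · rw [if_neg (by omega), if_pos h, DD_neg hg, if_neg (by omega), if_pos h, DD_neg hg]
    obtain ⟨m, rfl⟩ : ∃ m : ℕ, c = -m := ⟨(-c).toNat, by omega⟩
    rw [neg_neg, Int.toNat_natCast, change1 hf hg (by omega) a (-b) d (by linarith)]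
    ring
  · subst h
    simp
  · rw [if_pos h, if_pos h]
    obtain ⟨m, rfl⟩ : ∃ m : ℕ, c = m := ⟨c.toNat, by omega⟩
    rw [Int.toNat_natCast, change1 hf hg (by omega) a b d hdet]

lemma XX_main_pos {q₁ q₂ d : ℕ} {f g : ℤ → ℂ} (hf : CharLike q₂ f) (hg : CharLike q₁ g)
    (hd : 0 < d) (a b c : ℤ) (hdet : a * d - b * (c * (q₁ * q₂)) = 1) :
    XX f g q₁ q₂ a c = XX g f q₂ q₁ d (-b) := by
  rw [XX_recip hg hf hd a (-c) (-b) (by linarith), change2 hf hg hd a b c hdet]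
  have h1 := XX_recip hf hg hd a b c hdet
  rw [XX_change hf hg a b c d hdet] at h1
  have e1 : f d * f a = 1 := by
    rw [← hf.mul, show (d : ℤ) * a = 1 + q₂ * (b * c * q₁) by linarith, hf.per, hf.one]
  have e2 : g d * g a = 1 := by
    rw [← hg.mul, show (d : ℤ) * a = 1 + q₁ * (b * c * q₂) by linarith, hg.per, hg.one]
  linear_combination f d * g a * h1 - XX f g q₁ q₂ a c * (e1 * (g d * g a)) - XX f g q₁ q₂ a c * e2

lemma XX_main {q₁ q₂ : ℕ} {f g : ℤ → ℂ} (hf : CharLike q₂ f) (hg : CharLike q₁ g)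
    (hq : 1 < q₁) (a b c d : ℤ) (hdet : a * d - b * (c * (q₁ * q₂)) = 1) :
    XX f g q₁ q₂ a c = XX g f q₂ q₁ d (-b) := by
  rcases lt_trichotomy d 0 with h | h | h
  · obtain ⟨m, rfl⟩ : ∃ m : ℕ, d = -m := ⟨(-d).toNat, by omega⟩
    have := XX_main_pos hf hg (d := m) (by omega) (-a) (-b) (-c) (by linarith)
    rw [XX_neg] at this
    rw [this, ← XX_neg, neg_neg]
  · subst h
    exfalso
    have h1 : (q₁ : ℤ) ∣ 1 := ⟨-(b * c * q₂), by linarith⟩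
    have := Int.eq_one_of_dvd_one (by positivity) h1
    omega
  · obtain ⟨m, rfl⟩ : ∃ m : ℕ, d = m := ⟨d.toNat, by omega⟩
    exact XX_main_pos hf hg (by omega) a b c hdet

/-- The conjugate character as a function on the integers. -/
noncomputable def cf {q : ℕ} (χ : DirichletCharacter ℂ q) (x : ℤ) : ℂ :=
  (starRingEnd ℂ) (χ (x : ZMod q))

lemma cf_charLike {q : ℕ} (hq : 1 < q) (χ : DirichletCharacter ℂ q) (hp : χ.IsPrimitive)
    (he : χ.Even) : CharLike q (cf χ) where
  pos := by omega
  per x k := by simp [cf]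
  even x := by
    unfold cf
    rw [Int.cast_neg, he.eval_neg]
  zero x hx := by
    unfold cf
    rw [(ZMod.intCast_zmod_eq_zero_iff_dvd x q).2 hx]
    have : Fact (1 < q) := ⟨hq⟩
    rw [MulChar.map_zero, map_zero]
  sum := by
    have : NeZero q := ⟨by omega⟩
    have hne : χ ≠ 1 := by
      rintro rfl
      rw [DirichletCharacter.isPrimitive_def, DirichletCharacter.conductor_one] at hp
      omega
    have h := MulChar.sum_eq_zero_of_ne_one hne
    have h2 : ∑ n ∈ Finset.range q, χ (n : ZMod q) = 0 := by
      rw [← h]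
      refine Finset.sum_nbij' (fun n => (n : ZMod q)) (fun x => x.val) ?_ ?_ ?_ ?_ ?_
      · simp
      · intro x _; simpa using ZMod.val_lt x
      · intro n hn; exact ZMod.val_cast_of_lt (by simpa using hn)
      · intro x _; simp
      · simp
    unfold cf
    rw [← map_sum]
    simp [h2]
  mul x y := by simp [cf]
  one := by simp [cf]

lemma ded_eq {q₁ q₂ : ℕ} (χ₁ : DirichletCharacter ℂ q₁) (χ₂ : DirichletCharacter ℂ q₂)
    (a : ℤ) (m : ℕ) (C : ℤ) (hC : C = m * (q₁ * q₂)) :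
    ded χ₁ χ₂ a C = DD (cf χ₂) (cf χ₁) q₁ (m * q₁ * q₂) a := by
  obtain rfl : C = ((m * q₁ * q₂ : ℕ) : ℤ) := by rw [hC]; push_cast; ring
  unfold ded DD cf
  rw [Int.toNat_natCast]
  simp only [Int.cast_natCast]

lemma dedSL_eq {q₁ q₂ : ℕ} (hq₁ : 0 < q₁) (hq₂ : 0 < q₂)
    (χ₁ : DirichletCharacter ℂ q₁) (χ₂ : DirichletCharacter ℂ q₂)
    (a c : ℤ) (γ : SL(2, ℤ)) (h0 : (γ : Matrix (Fin 2) (Fin 2) ℤ) 0 0 = a)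
    (h1 : (γ : Matrix (Fin 2) (Fin 2) ℤ) 1 0 = c * (q₁ * q₂)) :
    dedSL χ₁ χ₂ γ = XX (cf χ₂) (cf χ₁) q₁ q₂ a c := by
  unfold dedSL XX
  rw [h0, h1]
  have hN : (0 : ℤ) < q₁ * q₂ := by positivity
  rcases lt_trichotomy c 0 with h | h | h
  · have hneg := mul_neg_of_neg_of_pos h hN
    rw [if_neg (by omega), if_pos hneg, if_neg (by omega), if_pos h]
    exact ded_eq _ _ _ _ _ (by rw [Int.toNat_of_nonneg (by omega)]; ring)
  · subst h; simp
  · rw [if_pos (mul_pos h hN), if_pos h]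
    exact ded_eq _ _ _ _ _ (by rw [Int.toNat_of_nonneg (by omega)])

/-- Reciprocity formula for even characters: `S_{χ₁,χ₂}(γ) = S_{χ₂,χ₁}(γ')`. -/
theorem reciprocity_even {q₁ q₂ : ℕ} (hq₁ : 1 < q₁) (hq₂ : 1 < q₂)
    (χ₁ : DirichletCharacter ℂ q₁) (χ₂ : DirichletCharacter ℂ q₂)
    (h₁ : χ₁.IsPrimitive) (h₂ : χ₂.IsPrimitive)
    (hpar : χ₁ (-1) * χ₂ (-1) = 1)
    (heven₁ : χ₁.Even) (heven₂ : χ₂.Even)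
    (a b c d : ℤ) (γ γ' : SL(2, ℤ))
    (hγ : (γ : Matrix (Fin 2) (Fin 2) ℤ) = !![a, b; c * (q₁ * q₂), d])
    (hγ' : (γ' : Matrix (Fin 2) (Fin 2) ℤ) = !![d, -c; -(b * (q₁ * q₂)), a]) :
    dedSL χ₁ χ₂ γ = dedSL χ₂ χ₁ γ' := by
  have hdet := γ.det_coe
  rw [hγ, Matrix.det_fin_two_of] at hdet
  rw [dedSL_eq (by omega) (by omega) χ₁ χ₂ a c γ (by simp [hγ]) (by simp [hγ]),
    dedSL_eq (by omega) (by omega) χ₂ χ₁ d (-b) γ' (by simp [hγ']) (by rw [hγ']; change -(b * ((q₁ : ℤ) * q₂)) = -b * (q₂ * q₁); ring)]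
  exact XX_main (cf_charLike hq₂ χ₂ h₂ heven₂) (cf_charLike hq₁ χ₁ h₁ heven₁) hq₁ a b c d hdet
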